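/- For every j ≥ 0 the finite generalized Jacobi matrix is self-adjoint with respect to the indefinite Gram matrix: G_{[0,j]} H_{[0,j]} = H_{[0,j]}ᵀ G_{[0,j]}, where G_{[0,j]} = blockdiag(ε_0 E_{p_0}^{−1}, ε_1 E_{p_1}^{−1}, …, ε_j E_{p_j}^{−1}). -/

import Mathlib

open Polynomial Matrix

/-- The symmetrizator `E_p` of a monic real polynomial of degree `n`:
`(E_p)_{ik} = p_{i+k+1}` when `i+k+1 ≤ n` (with `p_n = 1` since `p` is monic)
and `0` otherwise. -/
def symmetrizator (n : ℕ) (p : Polynomial ℝ) : Matrix (Fin n) (Fin n) ℝ :=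
  Matrix.of fun i j =>
    if (i : ℕ) + (j : ℕ) + 1 ≤ n then p.coeff ((i : ℕ) + (j : ℕ) + 1) else 0

/-- `nsum k j = n_j = k_0 + ⋯ + k_{j-1}`. -/
def nsum (k : ℕ → ℕ) (j : ℕ) : ℕ := ∑ i ∈ Finset.range j, k i

/-- The index `i` of the block containing the global row/column index `r`,
i.e. the greatest `i` with `n_i ≤ r` (assuming all `k i ≥ 1`). -/
def blkIdx (k : ℕ → ℕ) (r : ℕ) : ℕ := Nat.findGreatest (fun i => nsum k i ≤ r) r

/-- Entry of the (infinite) generalized Jacobi matrix at global position `(r, c)`: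
diagonal blocks are companion matrices `C_{p_i}`, subdiagonal blocks `B_i` have the
single nonzero entry `b_i` in the top-right corner, superdiagonal blocks `B̃_i` have
the single nonzero entry `ε_i ε_{i+1} b_i` in the top-right corner. -/
noncomputable def Jentry (ε b : ℕ → ℝ) (p : ℕ → Polynomial ℝ) (k : ℕ → ℕ) (r c : ℕ) : ℝ :=
  let i := blkIdx k r
  let i' := blkIdx k c
  let a := r - nsum k i
  let a' := c - nsum k i'
  if i = i' then
    (if a' = k i - 1 then -((p i).coeff a) else if a = a' + 1 then 1 else 0)
  else if i = i' + 1 then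
    (if a = 0 ∧ a' = k i' - 1 then b i' else 0)
  else if i' = i + 1 then
    (if a = 0 ∧ a' = k i' - 1 then ε i * ε i' * b i else 0)
  else 0

/-- The finite generalized Jacobi matrix built from the blocks indexed `0, …, m-1`;
it has size `n_m × n_m`.  Thus `H_{[0,j]} = JmatN ε b p k (j+1)`. -/
noncomputable def JmatN (ε b : ℕ → ℝ) (p : ℕ → Polynomial ℝ) (k : ℕ → ℕ) (m : ℕ) :
    Matrix (Fin (nsum k m)) (Fin (nsum k m)) ℝ :=
  Matrix.of fun r c => Jentry ε b p k (r : ℕ) (c : ℕ)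

/-- The block diagonal Gram matrix `G = blockdiag(ε_0 E_{p_0}⁻¹, …, ε_{m-1} E_{p_{m-1}}⁻¹)`
with `m` blocks. -/
noncomputable def GmatN (ε : ℕ → ℝ) (p : ℕ → Polynomial ℝ) (k : ℕ → ℕ) (m : ℕ) :
    Matrix (Fin (nsum k m)) (Fin (nsum k m)) ℝ :=
  Matrix.of fun r c =>
    let i := blkIdx k (r : ℕ)
    if blkIdx k (c : ℕ) = i then
      (if h : (r : ℕ) - nsum k i < k i ∧ (c : ℕ) - nsum k i < k i then
        ε i * (symmetrizator (k i) (p i))⁻¹ ⟨(r : ℕ) - nsum k i, h.1⟩ ⟨(c : ℕ) - nsum k i, h.2⟩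
      else 0)
    else 0

/-! ### Symmetrizators and companion matrices -/

/-- The companion matrix of a monic polynomial of degree `n`, with coefficients in the last
column. -/
noncomputable def lastColCompanion (n : ℕ) (p : Polynomial ℝ) : Matrix (Fin n) (Fin n) ℝ :=
  Matrix.of fun i j =>
    if (j : ℕ) = n - 1 then -(p.coeff i) else if (i : ℕ) = j + 1 then 1 else 0

theorem symmetrizator_transpose (n : ℕ) (p : Polynomial ℝ) :
    (symmetrizator n p)ᵀ = symmetrizator n p := by
  ext i j
  simp [symmetrizator, add_comm (i : ℕ)]

theorem isUnit_det_symmetrizator {n : ℕ} {p : Polynomial ℝ} (hp : p.Monic)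
    (hn : p.natDegree = n) : IsUnit (symmetrizator n p).det := by
  have hlead : p.coeff n = 1 := hn ▸ hp.coeff_natDegree
  have htri : ((symmetrizator n p).submatrix id Fin.revPerm).BlockTriangular id := by
    intro i j hij
    have : (j : ℕ) < i := hij
    simp only [symmetrizator, submatrix_apply, of_apply, id, Fin.revPerm_apply, Fin.val_rev]
    exact if_neg (by omega)
  have hdet := det_of_isUpperTriangular htri
  rw [det_permute', Finset.prod_eq_one] at hdet
  · exact isUnit_of_mul_isUnit_right (hdet ▸ isUnit_one)
  · intro i _
    have h : (i : ℕ) + (n - (i + 1)) + 1 = n := by omega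
    simp [symmetrizator, h, hlead, -Order.add_one_le_iff]

theorem inv_symmetrizator_transpose (n : ℕ) (p : Polynomial ℝ) :
    ((symmetrizator n p)⁻¹)ᵀ = (symmetrizator n p)⁻¹ := by
  rw [transpose_nonsing_inv, symmetrizator_transpose]

/-- The first column of the inverse symmetrizator is the last unit vector. -/
theorem inv_symmetrizator_apply_zero {n : ℕ} {p : Polynomial ℝ} (hp : p.Monic)
    (hn : p.natDegree = n) (i z : Fin n) (hz : (z : ℕ) = 0) :
    (symmetrizator n p)⁻¹ i z = if (i : ℕ) = n - 1 then 1 else 0 := by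
  have hlead : p.coeff n = 1 := hn ▸ hp.coeff_natDegree
  have hpos : 0 < n := i.pos
  let l : Fin n := ⟨n - 1, by omega⟩
  have hcol : symmetrizator n p *ᵥ Pi.single l 1 = Pi.single z 1 := by
    ext a
    rw [mulVec_single_one]
    by_cases ha : (a : ℕ) = 0
    · have : a = z := Fin.ext (ha.trans hz.symm)
      subst this
      have h : n - 1 + 1 = n := by omega
      simp [symmetrizator, l, ha, h, hlead, -Order.add_one_le_iff]
    · have : a ≠ z := fun h => ha (h ▸ hz)
      have h : ¬ ((a : ℕ) + (n - 1) + 1 ≤ n) := by omega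
      simp only [col_apply, symmetrizator, of_apply, l, if_neg h, Pi.single_eq_of_ne this]
  have hinv := congrArg ((symmetrizator n p)⁻¹ *ᵥ ·) hcol
  simp only [mulVec_mulVec, nonsing_inv_mul _ (isUnit_det_symmetrizator hp hn), one_mulVec] at hinv
  have := congrFun hinv i
  rw [mulVec_single_one, col_apply] at this
  rw [← this, Pi.single_apply]
  simp [l, Fin.ext_iff]

theorem lastColCompanion_mul_symmetrizator_apply {n : ℕ} {p : Polynomial ℝ} (hp : p.Monic)
    (hn : p.natDegree = n) (i k : Fin n) :
    (lastColCompanion n p * symmetrizator n p) i k =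
      if (i : ℕ) = 0 then (if (k : ℕ) = 0 then -p.coeff 0 else 0)
      else if (k : ℕ) = 0 then 0 else if (i : ℕ) + k ≤ n then p.coeff (i + k) else 0 := by
  have hlead : p.coeff n = 1 := hn ▸ hp.coeff_natDegree
  have hpos : 0 < n := i.pos
  let l : Fin n := ⟨n - 1, by omega⟩
  have hsplit : ∀ s : Fin n, lastColCompanion n p i s * symmetrizator n p s k =
      (if s = l then -p.coeff i * symmetrizator n p l k else 0) +
        (if (i : ℕ) = s + 1 then symmetrizator n p s k else 0) := by
    intro s
    by_cases hs : s = l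
    · subst hs
      have : (i : ℕ) ≠ n - 1 + 1 := by omega
      simp [lastColCompanion, l, this]
    · have : (s : ℕ) ≠ n - 1 := fun h => hs (Fin.ext h)
      simp [lastColCompanion, hs, this]
  have hl : symmetrizator n p l k = if (k : ℕ) = 0 then 1 else 0 := by
    have h : n - 1 + 1 = n := by omega
    by_cases hk : (k : ℕ) = 0
    · simp [symmetrizator, l, hk, h, hlead, -Order.add_one_le_iff]
    · simp only [symmetrizator, of_apply, l, if_neg hk]
      exact if_neg (by omega)
  rw [mul_apply, Finset.sum_congr rfl fun s _ => hsplit s, Finset.sum_add_distrib,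
    Finset.sum_ite_eq' Finset.univ l, if_pos (Finset.mem_univ l), hl]
  by_cases hi : (i : ℕ) = 0
  · simp [hi]
  · let t : Fin n := ⟨i - 1, by omega⟩
    have ht : ∀ s : Fin n, (i : ℕ) = s + 1 ↔ s = t := by
      intro s
      simp only [Fin.ext_iff, t]
      omega
    have h : (i : ℕ) - 1 + k + 1 = i + k := by omega
    simp only [ht, Finset.sum_ite_eq', Finset.mem_univ, if_true, if_neg hi]
    by_cases hk : (k : ℕ) = 0
    · have h' : (i : ℕ) - 1 + 1 = i := by omega
      simp [symmetrizator, t, hk, h', i.isLt.le, -Order.add_one_le_iff]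
    · simp [symmetrizator, t, hk, h, -Order.add_one_le_iff]

/-- The companion matrix is symmetric with respect to the inverse symmetrizator. -/
theorem inv_symmetrizator_mul_lastColCompanion {n : ℕ} {p : Polynomial ℝ} (hp : p.Monic)
    (hn : p.natDegree = n) :
    (symmetrizator n p)⁻¹ * lastColCompanion n p =
      (lastColCompanion n p)ᵀ * (symmetrizator n p)⁻¹ := by
  have hu := isUnit_det_symmetrizator hp hn
  have hsymm : lastColCompanion n p * symmetrizator n p =
      symmetrizator n p * (lastColCompanion n p)ᵀ := by
    have h : lastColCompanion n p * symmetrizator n p =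
        (lastColCompanion n p * symmetrizator n p)ᵀ := by
      ext i k
      rw [transpose_apply, lastColCompanion_mul_symmetrizator_apply hp hn,
        lastColCompanion_mul_symmetrizator_apply hp hn, add_comm (k : ℕ)]
      split_ifs <;> rfl
    rw [h, transpose_mul, symmetrizator_transpose]
  calc (symmetrizator n p)⁻¹ * lastColCompanion n p
      = (symmetrizator n p)⁻¹ * (lastColCompanion n p * symmetrizator n p) *
          (symmetrizator n p)⁻¹ := by
        rw [Matrix.mul_assoc, Matrix.mul_assoc, mul_nonsing_inv _ hu, Matrix.mul_one]
    _ = (lastColCompanion n p)ᵀ * (symmetrizator n p)⁻¹ := by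
        rw [hsymm, ← Matrix.mul_assoc, nonsing_inv_mul _ hu, Matrix.one_mul]

/-! ### Block indices -/

theorem nsum_succ (k : ℕ → ℕ) (j : ℕ) : nsum k (j + 1) = nsum k j + k j :=
  Finset.sum_range_succ _ _

theorem nsum_mono (k : ℕ → ℕ) : Monotone (nsum k) :=
  monotone_nat_of_le_succ fun j => by rw [nsum_succ]; omega

theorem le_nsum {k : ℕ → ℕ} (hk : ∀ j, 1 ≤ k j) (j : ℕ) : j ≤ nsum k j := by
  induction j with
  | zero => exact Nat.zero_le _
  | succ j ih => rw [nsum_succ]; have := hk j; omega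

theorem blkIdx_nsum_add {k : ℕ → ℕ} (hk : ∀ j, 1 ≤ k j) {i a : ℕ} (ha : a < k i) :
    blkIdx k (nsum k i + a) = i := by
  have hi := le_nsum hk i
  refine Nat.findGreatest_eq_iff.2 ⟨by omega, fun _ => by omega, fun l hl _ h => ?_⟩
  have := nsum_mono k (Nat.succ_le_of_lt hl)
  rw [Nat.succ_eq_add_one, nsum_succ] at this
  omega

theorem exists_eq_nsum_add {k : ℕ → ℕ} {m r : ℕ} (hr : r < nsum k m) :
    ∃ i < m, ∃ a : Fin (k i), r = nsum k i + a := by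
  induction m with
  | zero => simp [nsum] at hr
  | succ m ih =>
    by_cases h : r < nsum k m
    · obtain ⟨i, hi, a, ha⟩ := ih h
      exact ⟨i, by omega, a, ha⟩
    · rw [nsum_succ] at hr
      exact ⟨m, by omega, ⟨r - nsum k m, by omega⟩, by simp only; omega⟩

theorem sum_fin_nsum (k : ℕ → ℕ) (f : ℕ → ℝ) (m : ℕ) :
    ∑ r : Fin (nsum k m), f r = ∑ i ∈ Finset.range m, ∑ a : Fin (k i), f (nsum k i + a) := by
  rw [Fin.sum_univ_eq_sum_range f]
  induction m with
  | zero => simp [nsum]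
  | succ m ih =>
    rw [nsum_succ, Finset.sum_range_add, ih, Finset.sum_range_succ,
      Fin.sum_univ_eq_sum_range fun a => f (nsum k m + a)]

/-- A sum over global indices whose terms vanish off block `i` is a sum over that block. -/
theorem sum_fin_nsum_eq_block {k : ℕ → ℕ} (hk : ∀ j, 1 ≤ k j) {m i : ℕ} (hi : i < m) (f : ℕ → ℝ)
    (hf : ∀ r, blkIdx k r ≠ i → f r = 0) :
    ∑ r : Fin (nsum k m), f r = ∑ a : Fin (k i), f (nsum k i + a) := by
  rw [sum_fin_nsum]
  refine Finset.sum_eq_single_of_mem i (Finset.mem_range.2 hi) fun l _ hl => ?_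
  exact Finset.sum_eq_zero fun a _ => hf _ (by rwa [blkIdx_nsum_add hk a.isLt])

/-! ### Entries of the Gram and Jacobi matrices -/

/-- Entry of the infinite Gram matrix at global position `(r, c)`. -/
noncomputable def gramEntry (ε : ℕ → ℝ) (p : ℕ → Polynomial ℝ) (k : ℕ → ℕ) (r c : ℕ) : ℝ :=
  let i := blkIdx k r
  if blkIdx k c = i then
    (if h : r - nsum k i < k i ∧ c - nsum k i < k i then
      ε i * (symmetrizator (k i) (p i))⁻¹ ⟨r - nsum k i, h.1⟩ ⟨c - nsum k i, h.2⟩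
    else 0)
  else 0

theorem gramEntry_of_ne (ε : ℕ → ℝ) (p : ℕ → Polynomial ℝ) {k : ℕ → ℕ} {r c : ℕ}
    (h : blkIdx k c ≠ blkIdx k r) : gramEntry ε p k r c = 0 :=
  if_neg h

theorem gramEntry_block (ε : ℕ → ℝ) (p : ℕ → Polynomial ℝ) {k : ℕ → ℕ} (hk : ∀ j, 1 ≤ k j)
    {i : ℕ} (a s : Fin (k i)) :
    gramEntry ε p k (nsum k i + a) (nsum k i + s) = ε i * (symmetrizator (k i) (p i))⁻¹ a s := by
  have key : ∀ r c j, blkIdx k r = j → blkIdx k c = j → ∀ x y : Fin (k j),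
      r - nsum k j = x → c - nsum k j = y →
      gramEntry ε p k r c = ε j * (symmetrizator (k j) (p j))⁻¹ x y := by
    rintro r c j rfl hc x y hx hy
    have h : r - nsum k (blkIdx k r) < k (blkIdx k r) ∧
        c - nsum k (blkIdx k r) < k (blkIdx k r) := ⟨hx ▸ x.isLt, hy ▸ y.isLt⟩
    have hx' : (⟨_, h.1⟩ : Fin _) = x := Fin.ext hx
    have hy' : (⟨_, h.2⟩ : Fin _) = y := Fin.ext hy
    simp only [gramEntry, if_pos hc, dif_pos h, hx', hy']
  exact key _ _ i (blkIdx_nsum_add hk a.isLt) (blkIdx_nsum_add hk s.isLt) a s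
    (Nat.add_sub_cancel_left ..) (Nat.add_sub_cancel_left ..)

theorem Jentry_block (ε b : ℕ → ℝ) (p : ℕ → Polynomial ℝ) {k : ℕ → ℕ} (hk : ∀ j, 1 ≤ k j)
    {i i' : ℕ} (a : Fin (k i)) (a' : Fin (k i')) :
    Jentry ε b p k (nsum k i + a) (nsum k i' + a') =
      if i = i' then
        (if (a' : ℕ) = k i - 1 then -((p i).coeff a) else if (a : ℕ) = a' + 1 then 1 else 0)
      else if i = i' + 1 then (if (a : ℕ) = 0 ∧ (a' : ℕ) = k i' - 1 then b i' else 0)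
      else if i' = i + 1 then
        (if (a : ℕ) = 0 ∧ (a' : ℕ) = k i' - 1 then ε i * ε i' * b i else 0)
      else 0 := by
  simp only [Jentry, blkIdx_nsum_add hk a.isLt, blkIdx_nsum_add hk a'.isLt, Nat.add_sub_cancel_left]

/-- Multiplying the first column of `ε E_p⁻¹` by a row supported at `(0, k - 1)`. -/
theorem sum_inv_symmetrizator_mul {n : ℕ} {p : Polynomial ℝ} (hp : p.Monic)
    (hn : p.natDegree = n) (e x : ℝ) (Q : Prop) [Decidable Q] (a : Fin n) :
    ∑ s : Fin n, e * (symmetrizator n p)⁻¹ a s * (if (s : ℕ) = 0 ∧ Q then x else 0) =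
      if (a : ℕ) = n - 1 ∧ Q then e * x else 0 := by
  let z : Fin n := ⟨0, a.pos⟩
  rw [Finset.sum_eq_single_of_mem z (Finset.mem_univ z),
    inv_symmetrizator_apply_zero hp hn a z rfl]
  · by_cases ha : (a : ℕ) = n - 1 <;> by_cases hQ : Q <;> simp [ha, hQ, z]
  · intro s _ hs
    have : (s : ℕ) ≠ 0 := fun h => hs (Fin.ext h)
    simp [this]

theorem inv_symmetrizator_comm (n : ℕ) (p : Polynomial ℝ) (a s : Fin n) :
    (symmetrizator n p)⁻¹ s a = (symmetrizator n p)⁻¹ a s :=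
  congrFun (congrFun (inv_symmetrizator_transpose n p) a) s

/-- Blockwise form of the self-adjointness of the generalized Jacobi matrix. -/
theorem sum_gram_mul_Jentry_comm {ε : ℕ → ℝ} (b : ℕ → ℝ) {p : ℕ → Polynomial ℝ} {k : ℕ → ℕ}
    (hε : ∀ j, ε j = 1 ∨ ε j = -1) (hp : ∀ j, (p j).Monic)
    (hdeg : ∀ j, (p j).natDegree = k j) (hk : ∀ j, 1 ≤ k j)
    {i i' : ℕ} (a : Fin (k i)) (a' : Fin (k i')) :
    ∑ s : Fin (k i), ε i * (symmetrizator (k i) (p i))⁻¹ a s *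
        Jentry ε b p k (nsum k i + s) (nsum k i' + a') =
      ∑ s : Fin (k i'), ε i' * (symmetrizator (k i') (p i'))⁻¹ a' s *
        Jentry ε b p k (nsum k i' + s) (nsum k i + a) := by
  have hsq : ∀ j, ε j * ε j = 1 := fun j => by rcases hε j with h | h <;> simp [h]
  simp only [Jentry_block ε b p hk]
  rcases eq_or_ne i i' with rfl | hne
  · have h := congrFun (congrFun
      (inv_symmetrizator_mul_lastColCompanion (hp i) (hdeg i)) a) a'
    simp only [mul_apply, transpose_apply, lastColCompanion, of_apply] at h
    simp only [if_true, mul_assoc, ← Finset.mul_sum]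
    rw [h]
    congr 1
    exact Finset.sum_congr rfl fun s _ => by rw [mul_comm, inv_symmetrizator_comm]
  simp only [if_neg hne, if_neg hne.symm]
  by_cases h1 : i = i' + 1
  · have h2 : ¬ i' = i + 1 := by omega
    simp only [if_pos h1, if_neg h2, sum_inv_symmetrizator_mul (hp _) (hdeg _)]
    simp only [and_comm (a := (a : ℕ) = k i - 1), ← mul_assoc, hsq, one_mul]
  by_cases h2 : i' = i + 1
  · simp only [if_pos h2, if_neg h1, sum_inv_symmetrizator_mul (hp _) (hdeg _)]
    simp only [and_comm (a := (a : ℕ) = k i - 1), ← mul_assoc, hsq, one_mul]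
  · simp [h1, h2]

/-- For every `j ≥ 0` the finite generalized Jacobi matrix `H_{[0,j]}` is self-adjoint
with respect to the indefinite Gram matrix `G_{[0,j]}`:
`G_{[0,j]} H_{[0,j]} = H_{[0,j]}ᵀ G_{[0,j]}`. -/
theorem Gmat_mul_Jmat_eq_transpose_mul (ε b : ℕ → ℝ) (p : ℕ → Polynomial ℝ) (k : ℕ → ℕ)
    (hε : ∀ j, ε j = 1 ∨ ε j = -1) (hb : ∀ j, 0 < b j)
    (hp : ∀ j, (p j).Monic) (hdeg : ∀ j, (p j).natDegree = k j) (hk : ∀ j, 1 ≤ k j) :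
    ∀ j : ℕ,
      GmatN ε p k (j + 1) * JmatN ε b p k (j + 1) =
        (JmatN ε b p k (j + 1))ᵀ * GmatN ε p k (j + 1) := by
  intro j
  ext r c
  obtain ⟨i, hi, a, hr⟩ := exists_eq_nsum_add r.isLt
  obtain ⟨i', hi', a', hc⟩ := exists_eq_nsum_add c.isLt
  calc (GmatN ε p k (j + 1) * JmatN ε b p k (j + 1)) r c
      = ∑ s : Fin (nsum k (j + 1)), gramEntry ε p k r s * Jentry ε b p k s c := rfl
    _ = ∑ s : Fin (k i), ε i * (symmetrizator (k i) (p i))⁻¹ a s *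
          Jentry ε b p k (nsum k i + s) (nsum k i' + a') := by
        rw [sum_fin_nsum_eq_block hk hi fun s => gramEntry ε p k r s * Jentry ε b p k s c]
        · simp only [hr, hc, gramEntry_block ε p hk]
        · intro s hs
          rw [gramEntry_of_ne, zero_mul]
          rwa [hr, blkIdx_nsum_add hk a.isLt]
    _ = ∑ s : Fin (k i'), ε i' * (symmetrizator (k i') (p i'))⁻¹ a' s *
          Jentry ε b p k (nsum k i' + s) (nsum k i + a) :=
        sum_gram_mul_Jentry_comm b hε hp hdeg hk a a'
    _ = ∑ s : Fin (nsum k (j + 1)), Jentry ε b p k s r * gramEntry ε p k s c := by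
        rw [sum_fin_nsum_eq_block hk hi' fun s => Jentry ε b p k s r * gramEntry ε p k s c]
        · simp only [hr, hc, gramEntry_block ε p hk]
          exact Finset.sum_congr rfl fun s _ => by rw [inv_symmetrizator_comm, mul_comm]
        · intro s hs
          rw [gramEntry_of_ne, mul_zero]
          rw [hc, blkIdx_nsum_add hk a'.isLt]
          exact hs.symm
    _ = ((JmatN ε b p k (j + 1))ᵀ * GmatN ε p k (j + 1)) r c := rfl
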